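/- Let ζ = ψ∘λ with ψ symmetric convex piecewise affine, K = {X ∈ Sⁿ : ζ(X) ≤ 0} satisfying Slater's condition, X̄ ∈ K and Z̄ ∈ N_K(X̄). Then for any S ∈ ∂Π_K(X̄+Z̄) (Clarke's generalized Jacobian of the metric projection onto K) and any pair (ΔX, ΔZ) ∈ Sⁿ×Sⁿ satisfying ΔX = S(ΔX + ΔZ), one has ⟨ΔX, ΔZ⟩ ≥ −Υ²_{X̄}(Z̄, ΔX), where Υ²_{X̄}(Z̄,H) := 2 ∑_{l=1}^{r} ⟨ Λ(Z̄)_{α^l α^l}, V̄ᵀ_{α^l} H (X̄ − v̄_l I)† H V̄_{α^l} ⟩ for V̄ ∈ 𝕆ⁿ(X̄) ∩ 𝕆ⁿ(Z̄). -/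

import Mathlib

open Matrix Filter Topology Set
open scoped Classical

noncomputable section

/-- The vector of eigenvalues of a symmetric matrix, in non-increasing order. -/
noncomputable def lamVec {n : ℕ} (X : Matrix (Fin n) (Fin n) ℝ) : Fin n → ℝ :=
  if h : X.IsHermitian then fun i => (h.eigenvalues ∘ Tuple.sort h.eigenvalues) i.rev else 0

/-- The set `𝕆ⁿ(X)` of orthogonal matrices giving an ordered eigenvalue decomposition of `X`. -/
def OSet {n : ℕ} (X : Matrix (Fin n) (Fin n) ℝ) : Set (Matrix (Fin n) (Fin n) ℝ) :=
  {U | Uᵀ * U = 1 ∧ X = U * Matrix.diagonal (lamVec X) * Uᵀ}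

/-- One-sided directional derivative of a scalar function. -/
noncomputable def dirDeriv {E : Type*} [AddCommMonoid E] [Module ℝ E] (f : E → ℝ) (x h : E) : ℝ :=
  limUnder (𝓝[>] (0:ℝ)) fun t => (f (x + t • h) - f x) / t

/-- Vector of one-sided directional derivatives of the ordered eigenvalues: `λ'(X;H)`. -/
noncomputable def lamDD {n : ℕ} (X H : Matrix (Fin n) (Fin n) ℝ) : Fin n → ℝ :=
  fun i => dirDeriv (fun Y => lamVec Y i) X H

/-- The max-of-affine convex piecewise affine function `φ(x) = max_i (⟨aⁱ,x⟩ - cᵢ)`. -/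
noncomputable def pwa {n p : ℕ} [NeZero p] (a : Fin p → Fin n → ℝ) (c : Fin p → ℝ)
    (x : Fin n → ℝ) : ℝ :=
  ⨆ i, (a i ⬝ᵥ x - c i)

/-- The active index set `ι(x̄)` of a max-of-affine function at `x̄`. -/
def iotaA {n p : ℕ} [NeZero p] (a : Fin p → Fin n → ℝ) (c : Fin p → ℝ)
    (x : Fin n → ℝ) : Set (Fin p) :=
  {i | a i ⬝ᵥ x - c i = pwa a c x}

/-- Frobenius inner product of two matrices. -/
def mip {n : ℕ} (A B : Matrix (Fin n) (Fin n) ℝ) : ℝ := (Aᵀ * B).trace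

/-- Convex subdifferential (over the space of symmetric matrices) of a real function. -/
def msubdiff {n : ℕ} (f : Matrix (Fin n) (Fin n) ℝ → ℝ) (X : Matrix (Fin n) (Fin n) ℝ) :
    Set (Matrix (Fin n) (Fin n) ℝ) :=
  {G | G.IsSymm ∧ ∀ Y : Matrix (Fin n) (Fin n) ℝ, Y.IsSymm → f X + mip G (Y - X) ≤ f Y}

/-- Moore–Penrose pseudo-inverse, via the four Penrose conditions. -/
noncomputable def mpInv {n : ℕ} (A : Matrix (Fin n) (Fin n) ℝ) : Matrix (Fin n) (Fin n) ℝ :=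
  Classical.epsilon fun B => A * B * A = A ∧ B * A * B = B ∧ (A * B)ᵀ = A * B ∧ (B * A)ᵀ = B * A

/-- The sigma-term function
`Υ_X(Y,H) = 2 ∑_l ⟨Λ(Y)_{αˡαˡ}, Uᵀ_{αˡ} H (X - v̄ₗ I)† H U_{αˡ}⟩` (written as a single sum
over eigenvalue indices). -/
noncomputable def Upsilon {n : ℕ} (X Y U H : Matrix (Fin n) (Fin n) ℝ) : ℝ :=
  2 * ∑ i, lamVec Y i *
    ((Uᵀ * H * mpInv (X - lamVec X i • (1 : Matrix (Fin n) (Fin n) ℝ)) * H * U) i i)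

/-- The active index set `ι₂(x̄) = {i : ⟨bⁱ,x̄⟩ = dᵢ}`. -/
def iotaC {n q : ℕ} (b : Fin q → Fin n → ℝ) (d : Fin q → ℝ) (x : Fin n → ℝ) : Set (Fin q) :=
  {i | b i ⬝ᵥ x = d i}

/-- The index set `η₂(x̄,z̄)`: active indices carrying a strictly positive weight in some
conic-combination representation of `z̄` by the active `bⁱ`'s. -/
def etaC {n q : ℕ} (b : Fin q → Fin n → ℝ) (d : Fin q → ℝ)
    (x z : Fin n → ℝ) : Set (Fin q) :=
  {i | ∃ u : Fin q → ℝ, (∀ j, 0 ≤ u j) ∧ (∀ j, j ∉ iotaC b d x → u j = 0) ∧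
        z = ∑ j, u j • b j ∧ 0 < u i}

/-- The normal cone (within `Sⁿ`) of a set of symmetric matrices. -/
def NK {n : ℕ} (K : Set (Matrix (Fin n) (Fin n) ℝ)) (X : Matrix (Fin n) (Fin n) ℝ) :
    Set (Matrix (Fin n) (Fin n) ℝ) :=
  {Z | Z.IsSymm ∧ ∀ Y ∈ K, mip Z (Y - X) ≤ 0}

/-- `i` and `j` belong to the same block `αˡ` of `X̄`. -/
def sameA {n : ℕ} (X : Matrix (Fin n) (Fin n) ℝ) (i j : Fin n) : Prop :=
  lamVec X i = lamVec X j

/-- `i` and `j` belong to the same sub-block `γˡₖ` (determined by the eigenvalues of both `X̄`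
and `Z̄`). -/
def sameG {n : ℕ} (X Z : Matrix (Fin n) (Fin n) ℝ) (i j : Fin n) : Prop :=
  lamVec X i = lamVec X j ∧ lamVec Z i = lamVec Z j

/-- The sub-block `γˡₖ` containing `i` is a "bad" block, i.e. `k ∈ Fₗ`: some `b^w`,
`w ∈ η₂(λ(X̄),λ(Z̄))`, is non-constant on it. -/
def badG {n q : ℕ} (b : Fin q → Fin n → ℝ) (d : Fin q → ℝ)
    (X Z : Matrix (Fin n) (Fin n) ℝ) (i : Fin n) : Prop :=
  ∃ z z' : Fin n, sameG X Z z i ∧ sameG X Z z' i ∧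
    ∃ w ∈ etaC b d (lamVec X) (lamVec Z), b w z ≠ b w z'

/-- Proximal point of a real function on the space of symmetric matrices. -/
noncomputable def proxM {n : ℕ} (f : Matrix (Fin n) (Fin n) ℝ → ℝ)
    (X : Matrix (Fin n) (Fin n) ℝ) : Matrix (Fin n) (Fin n) ℝ :=
  Classical.epsilon fun W => W.IsSymm ∧ ∀ U : Matrix (Fin n) (Fin n) ℝ, U.IsSymm →
    f W + mip (W - X) (W - X) / 2 ≤ f U + mip (U - X) (U - X) / 2

/-- Metric projection onto a subset of matrix space. -/
noncomputable def projM {n : ℕ} (K : Set (Matrix (Fin n) (Fin n) ℝ))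
    (X : Matrix (Fin n) (Fin n) ℝ) : Matrix (Fin n) (Fin n) ℝ :=
  Classical.epsilon fun W => W ∈ K ∧ ∀ U ∈ K, mip (W - X) (W - X) ≤ mip (U - X) (U - X)

attribute [local instance] Matrix.normedAddCommGroup Matrix.normedSpace

/-- Clarke's generalized Jacobian of a (locally Lipschitz) map between normed spaces:  the
convex hull of all limits of Jacobians along sequences of points of differentiability. -/
def clarkeJacobian {E F : Type*} [NormedAddCommGroup E] [NormedSpace ℝ E]
    [NormedAddCommGroup F] [NormedSpace ℝ F] (G : E → F) (x : E) : Set (E →L[ℝ] F) :=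
  convexHull ℝ {L : E →L[ℝ] F | ∃ u : ℕ → E, (∀ k, DifferentiableAt ℝ G (u k)) ∧
    Filter.Tendsto u Filter.atTop (𝓝 x) ∧
    Filter.Tendsto (fun k => fderiv ℝ G (u k)) Filter.atTop (𝓝 L)}

/-! ### Basic facts on the Frobenius inner product -/

abbrev RM (n : ℕ) := Matrix (Fin n) (Fin n) ℝ

lemma mip_eq {n : ℕ} (A B : RM n) : mip A B = ∑ i, ∑ j, A i j * B i j := by
  unfold mip
  rw [Finset.sum_comm]
  simp [Matrix.trace, Matrix.mul_apply]

lemma mip_comm' {n : ℕ} (A B : RM n) : mip A B = mip B A := by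
  simp only [mip_eq, mul_comm]

lemma mip_add_left {n : ℕ} (A B C : RM n) : mip (A + B) C = mip A C + mip B C := by
  simp [mip, add_mul]

lemma mip_add_right {n : ℕ} (A B C : RM n) : mip A (B + C) = mip A B + mip A C := by
  simp [mip, mul_add]

lemma mip_sub_left {n : ℕ} (A B C : RM n) : mip (A - B) C = mip A C - mip B C := by
  simp [mip, sub_mul]

lemma mip_sub_right {n : ℕ} (A B C : RM n) : mip A (B - C) = mip A B - mip A C := by
  simp [mip, mul_sub]

lemma mip_smul_left {n : ℕ} (c : ℝ) (A B : RM n) : mip (c • A) B = c * mip A B := by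
  simp [mip]

lemma mip_smul_right {n : ℕ} (c : ℝ) (A B : RM n) : mip A (c • B) = c * mip A B := by
  simp [mip]

lemma mip_self_nonneg {n : ℕ} (A : RM n) : 0 ≤ mip A A := by
  rw [mip_eq]
  exact Finset.sum_nonneg fun i _ => Finset.sum_nonneg fun j _ => mul_self_nonneg _

lemma sq_le_mip {n : ℕ} (A : RM n) (i j : Fin n) : A i j * A i j ≤ mip A A := by
  rw [mip_eq]
  have h1 : A i j * A i j ≤ ∑ j, A i j * A i j :=
    Finset.single_le_sum (f := fun j => A i j * A i j) (fun j _ => mul_self_nonneg _)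
      (Finset.mem_univ j)
  have h2 : ∑ j, A i j * A i j ≤ ∑ i, ∑ j, A i j * A i j :=
    Finset.single_le_sum (f := fun i => ∑ j, A i j * A i j)
      (fun i _ => Finset.sum_nonneg fun j _ => mul_self_nonneg _) (Finset.mem_univ i)
  exact h1.trans h2

lemma eq_zero_of_mip {n : ℕ} {A : RM n} (h : mip A A ≤ 0) : A = 0 := by
  ext i j
  have := sq_le_mip A i j
  have h0 : A i j * A i j = 0 := le_antisymm (this.trans h) (mul_self_nonneg _)
  simpa using h0

lemma mip_transpose {n : ℕ} (A B : RM n) : mip Aᵀ Bᵀ = mip A B := by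
  simp only [mip_eq, Matrix.transpose_apply]
  rw [Finset.sum_comm]

lemma mip_conj {n : ℕ} {R : RM n} (hR : Rᵀ * R = 1) (A B : RM n) :
    mip (R * A * Rᵀ) (R * B * Rᵀ) = mip A B := by
  unfold mip
  have : (R * A * Rᵀ)ᵀ * (R * B * Rᵀ) = R * (Aᵀ * (Rᵀ * R) * B * Rᵀ) := by
    simp only [Matrix.transpose_mul, Matrix.transpose_transpose, Matrix.mul_assoc]
  rw [this, hR, Matrix.trace_mul_comm]
  simp only [Matrix.mul_one, Matrix.mul_assoc, hR]

lemma continuous_mip {n : ℕ} {T : Type*} [TopologicalSpace T] {f g : T → RM n}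
    (hf : Continuous f) (hg : Continuous g) : Continuous fun t => mip (f t) (g t) := by
  unfold mip
  exact (hf.matrix_transpose.matrix_mul hg).matrix_trace

lemma norm_le_of_mip {n : ℕ} {A : RM n} {c : ℝ} (hc : 0 ≤ c) (h : mip A A ≤ c ^ 2) :
    ‖A‖ ≤ c := by
  rw [Matrix.norm_le_iff hc]
  intro i j
  have := sq_le_mip A i j
  rw [Real.norm_eq_abs]
  exact abs_le_of_sq_le_sq (by nlinarith) hc

lemma mip_le_norm {n : ℕ} (A : RM n) : mip A A ≤ ((n : ℝ) * ‖A‖) ^ 2 := by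
  rw [mip_eq]
  have : ∀ i j, A i j * A i j ≤ ‖A‖ ^ 2 := by
    intro i j
    have h := Matrix.norm_entry_le_entrywise_sup_norm A (i := i) (j := j)
    rw [Real.norm_eq_abs] at h
    nlinarith [abs_nonneg (A i j), sq_abs (A i j)]
  calc ∑ i, ∑ j, A i j * A i j ≤ ∑ i : Fin n, ∑ j : Fin n, ‖A‖ ^ 2 :=
        Finset.sum_le_sum fun i _ => Finset.sum_le_sum fun j _ => this i j
    _ = _ := by simp; ring

/-! ### Projection onto closed convex sets -/

def IsProj {n : ℕ} (K : Set (RM n)) (X W : RM n) : Prop :=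
  W ∈ K ∧ ∀ U ∈ K, mip (W - X) (W - X) ≤ mip (U - X) (U - X)

lemma exists_isProj {n : ℕ} {K : Set (RM n)} (hne : K.Nonempty) (hcl : IsClosed K) (X : RM n) :
    ∃ W, IsProj K X W := by
  obtain ⟨Y, hY⟩ := hne
  have hcont : Continuous fun W : RM n => mip (W - X) (W - X) :=
    continuous_mip (continuous_id.sub continuous_const) (continuous_id.sub continuous_const)
  have hcpt : IsCompact (K ∩ {W | mip (W - X) (W - X) ≤ mip (Y - X) (Y - X)}) := by
    apply Metric.isCompact_of_isClosed_isBounded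
    · exact hcl.inter (isClosed_le hcont continuous_const)
    · refine (Metric.isBounded_closedBall (x := X)
        (r := Real.sqrt (mip (Y - X) (Y - X)))).subset ?_
      rintro W ⟨_, hW⟩
      rw [Metric.mem_closedBall, dist_eq_norm]
      apply norm_le_of_mip (Real.sqrt_nonneg _)
      rw [Real.sq_sqrt (mip_self_nonneg _)]
      exact hW
  obtain ⟨W, hW, hmin⟩ := hcpt.exists_isMinOn ⟨Y, hY, by simp⟩ hcont.continuousOn
  refine ⟨W, hW.1, fun U hU => ?_⟩
  by_cases h : mip (U - X) (U - X) ≤ mip (Y - X) (Y - X)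
  · exact hmin ⟨hU, h⟩
  · exact hW.2.trans (le_of_not_ge h)

lemma projM_isProj {n : ℕ} {K : Set (RM n)} (hne : K.Nonempty) (hcl : IsClosed K) (X : RM n) :
    IsProj K X (projM K X) :=
  Classical.epsilon_spec (exists_isProj hne hcl X)

lemma IsProj.vi {n : ℕ} {K : Set (RM n)} (hcv : Convex ℝ K) {X W : RM n} (h : IsProj K X W)
    {Y : RM n} (hY : Y ∈ K) : mip (X - W) (Y - W) ≤ 0 := by
  by_contra hpos
  push Not at hpos
  set p := mip (X - W) (Y - W) with hp
  set s := mip (Y - W) (Y - W) with hs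
  have hs0 : 0 ≤ s := mip_self_nonneg _
  have key : ∀ t : ℝ, 0 ≤ t → t ≤ 1 → 2 * t * p ≤ t ^ 2 * s := by
    intro t h0 h1
    have hm : W + t • (Y - W) ∈ K := by
      have := hcv h.1 hY (a := 1 - t) (b := t) (by linarith) h0 (by ring)
      convert this using 1
      module
    have := h.2 _ hm
    have e : W + t • (Y - W) - X = t • (Y - W) - (X - W) := by abel
    have e2 : W - X = -(1:ℝ) • (X - W) := by module
    rw [e, e2] at this
    simp only [mip_sub_left (t • (Y - W)), mip_sub_right _ (t • (Y - W)), mip_smul_left,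
      mip_smul_right] at this
    rw [mip_comm' (Y - W) (X - W), ← hp, ← hs] at this
    nlinarith
  rcases eq_or_lt_of_le hs0 with h0 | h0
  · have := key 1 (by norm_num) le_rfl
    nlinarith
  · have h1 := key (min 1 (p / s)) (by positivity) (min_le_left _ _)
    have h2 : min 1 (p / s) * s ≤ p := by
      calc min 1 (p / s) * s ≤ p / s * s := by gcongr; exact min_le_right _ _
        _ = p := by field_simp
    have h3 : 0 < min 1 (p / s) := by positivity
    nlinarith

lemma vi_firm {n : ℕ} {K : Set (RM n)} {X W X' W' : RM n}
    (hW : W ∈ K) (hv : ∀ Y ∈ K, mip (X - W) (Y - W) ≤ 0)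
    (hW' : W' ∈ K) (hv' : ∀ Y ∈ K, mip (X' - W') (Y - W') ≤ 0) :
    mip (W' - W) (W' - W) ≤ mip (W' - W) (X' - X) := by
  have h1 := hv W' hW'
  have h2 := hv' W hW
  simp only [mip_sub_left, mip_sub_right] at *
  have := mip_comm' X W
  have := mip_comm' X W'
  have := mip_comm' X' W
  have := mip_comm' X' W'
  have := mip_comm' W W'
  linarith

lemma vi_unique {n : ℕ} {K : Set (RM n)} {X W W' : RM n}
    (hW : W ∈ K) (hv : ∀ Y ∈ K, mip (X - W) (Y - W) ≤ 0)
    (hW' : W' ∈ K) (hv' : ∀ Y ∈ K, mip (X - W') (Y - W') ≤ 0) : W' = W := by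
  have := vi_firm hW hv hW' hv'
  rw [sub_self] at this
  have h0 : mip (W' - W) 0 = 0 := by simp [mip]
  rw [h0] at this
  exact sub_eq_zero.mp (eq_zero_of_mip this)

/-- The abstract data on `G = Π_K` used below. -/
structure ProjData {n : ℕ} (K : Set (RM n)) (G : RM n → RM n) : Prop where
  mem : ∀ X, G X ∈ K
  vi : ∀ X, ∀ Y ∈ K, mip (X - G X) (Y - G X) ≤ 0
  symm : ∀ X ∈ K, X.IsSymm
  inv : ∀ R : RM n, Rᵀ * R = 1 → ∀ X ∈ K, R * X * Rᵀ ∈ K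

namespace ProjData

variable {n : ℕ} {K : Set (RM n)} {G : RM n → RM n}

lemma firm (h : ProjData K G) (X Y : RM n) :
    mip (G Y - G X) (G Y - G X) ≤ mip (G Y - G X) (Y - X) :=
  vi_firm (h.mem X) (h.vi X) (h.mem Y) (h.vi Y)

lemma lip (h : ProjData K G) (X Y : RM n) :
    mip (G Y - G X) (G Y - G X) ≤ mip (Y - X) (Y - X) := by
  have h1 := h.firm X Y
  have h2 := mip_self_nonneg ((G Y - G X) - (Y - X))
  rw [mip_sub_left _ (Y - X), mip_sub_right _ _ (Y - X), mip_sub_right _ _ (Y - X),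
    mip_comm' (Y - X) (G Y - G X)] at h2
  linarith

lemma cont (h : ProjData K G) : Continuous G := by
  have : LipschitzWith (n : NNReal) G := by
    apply LipschitzWith.of_dist_le_mul
    intro X Y
    rw [dist_eq_norm, dist_eq_norm]
    apply norm_le_of_mip (by positivity)
    exact (h.lip Y X).trans (mip_le_norm _)
  exact this.continuous

lemma equivar (h : ProjData K G) {R : RM n} (hR : Rᵀ * R = 1) (X : RM n) :
    G (R * X * Rᵀ) = R * G X * Rᵀ := by
  have hR' : R * Rᵀ = 1 := mul_eq_one_comm.mp hR
  refine vi_unique (h.inv R hR _ (h.mem X)) ?_ (h.mem _) (h.vi _)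
  intro Y hY
  have hm : Rᵀ * Y * Rᵀᵀ ∈ K := h.inv Rᵀ (by simpa using hR') Y hY
  rw [Matrix.transpose_transpose] at hm
  have := h.vi X _ hm
  rw [← mip_conj hR] at this
  have e1 : R * (X - G X) * Rᵀ = R * X * Rᵀ - R * G X * Rᵀ := by
    rw [Matrix.mul_sub, Matrix.sub_mul]
  have e2 : R * (Rᵀ * Y * R - G X) * Rᵀ = Y - R * G X * Rᵀ := by
    rw [Matrix.mul_sub, Matrix.sub_mul]
    congr 1
    calc R * (Rᵀ * Y * R) * Rᵀ = (R * Rᵀ) * Y * (R * Rᵀ) := by simp only [Matrix.mul_assoc]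
      _ = Y := by simp [hR']
  rwa [e1, e2] at this

lemma symPart (h : ProjData K G) (X : RM n) : G ((1/2 : ℝ) • (X + Xᵀ)) = G X := by
  refine vi_unique (h.mem X) ?_ (h.mem _) (h.vi _) 
  intro Y hY
  have e : (1/2 : ℝ) • (X + Xᵀ) - G X = (1/2 : ℝ) • ((X - G X) + (X - G X)ᵀ) := by
    rw [Matrix.transpose_sub, (h.symm _ (h.mem X)).eq]; module
  rw [e, mip_smul_left, mip_add_left]
  have hs : (Y - G X)ᵀ = Y - G X := by
    rw [Matrix.transpose_sub, (h.symm _ (h.mem X)).eq, (h.symm _ hY).eq]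
  have : mip (X - G X)ᵀ (Y - G X) = mip (X - G X) (Y - G X) := by
    conv_lhs => rw [← hs]
    exact mip_transpose _ _
  rw [this]
  have := h.vi X Y hY
  linarith

end ProjData

/-! ### Spectral decomposition -/

lemma spectral_real {n : ℕ} {X : RM n} (h : X.IsHermitian) :
    ∃ V : RM n, Vᵀ * V = 1 ∧ X = V * Matrix.diagonal h.eigenvalues * Vᵀ := by
  refine ⟨(h.eigenvectorUnitary : RM n), ?_, ?_⟩
  · have := Unitary.coe_star_mul_self h.eigenvectorUnitary
    simpa [Matrix.star_eq_conjTranspose] using this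
  · have := h.spectral_theorem
    rw [Unitary.conjStarAlgAut_apply] at this
    simpa [Matrix.star_eq_conjTranspose, Function.comp_def] using this

lemma isHermitian_of_isSymm {n : ℕ} {X : RM n} (h : X.IsSymm) : X.IsHermitian := by
  rw [Matrix.IsHermitian, Matrix.conjTranspose_eq_transpose_of_trivial]; exact h

lemma conj_apply_diag {n : ℕ} (s : Fin n → ℝ) (M : RM n) (i j : Fin n) :
    (Matrix.diagonal s * M * Matrix.diagonal s) i j = s i * M i j * s j := by
  rw [Matrix.mul_diagonal, Matrix.diagonal_mul]

namespace ProjData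

variable {n : ℕ} {K : Set (RM n)} {G : RM n → RM n}

lemma commute_symm (h : ProjData K G) {U : RM n} (hU : U.IsSymm) : G U * U = U * G U := by
  obtain ⟨V, hV, hd⟩ := spectral_real (isHermitian_of_isSymm hU)
  set u := (isHermitian_of_isSymm hU).eigenvalues with hu
  have hV' : V * Vᵀ = 1 := mul_eq_one_comm.mp hV
  set M := Vᵀ * G U * V with hM
  have hGM : G U = V * M * Vᵀ := by
    calc G U = (V * Vᵀ) * G U * (V * Vᵀ) := by simp [hV']
      _ = _ := by simp only [hM, Matrix.mul_assoc]
  have key : ∀ s : Fin n → ℝ, (∀ i, s i * s i = 1) → ∀ i j, s i * M i j * s j = M i j := by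
    intro s hs i j
    have hss : Matrix.diagonal s * Matrix.diagonal s = (1 : RM n) := by
      rw [Matrix.diagonal_mul_diagonal, ← Matrix.diagonal_one]
      congr 1; funext i; exact hs i
    have hRt : (V * Matrix.diagonal s * Vᵀ)ᵀ = V * Matrix.diagonal s * Vᵀ := by
      simp [Matrix.mul_assoc]
    have hmm : ∀ A B : RM n, (V * A * Vᵀ) * (V * B * Vᵀ) = V * (A * B) * Vᵀ := by
      intro A B
      calc (V * A * Vᵀ) * (V * B * Vᵀ) = V * A * (Vᵀ * V) * B * Vᵀ := by
            simp only [Matrix.mul_assoc]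
        _ = _ := by simp [hV, Matrix.mul_assoc]
    have hR : (V * Matrix.diagonal s * Vᵀ)ᵀ * (V * Matrix.diagonal s * Vᵀ) = 1 := by
      rw [hRt, hmm, hss, Matrix.mul_one, hV']
    have he := h.equivar hR U
    have hcomm : Matrix.diagonal s * Matrix.diagonal u * Matrix.diagonal s
        = (Matrix.diagonal u : RM n) := by
      rw [Matrix.diagonal_mul_diagonal, Matrix.diagonal_mul_diagonal]
      congr 1; funext i
      linear_combination u i * hs i
    have hfix : (V * Matrix.diagonal s * Vᵀ) * U * (V * Matrix.diagonal s * Vᵀ)ᵀ = U := by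
      rw [hRt]
      conv_lhs => rw [hd]
      rw [hmm, hmm, hcomm]
      exact hd.symm
    rw [hfix, hRt, hGM, hmm, hmm] at he
    have h2 : Matrix.diagonal s * M * Matrix.diagonal s = M := by
      have : Vᵀ * (V * M * Vᵀ) * V = Vᵀ * (V * (Matrix.diagonal s * M * Matrix.diagonal s) * Vᵀ) * V := by
        rw [← he]
      have cl : ∀ A : RM n, Vᵀ * (V * A * Vᵀ) * V = A := by
        intro A
        calc Vᵀ * (V * A * Vᵀ) * V = (Vᵀ * V) * A * (Vᵀ * V) := by simp only [Matrix.mul_assoc]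
          _ = A := by simp [hV]
      rw [cl, cl] at this
      exact this.symm
    rw [← conj_apply_diag, h2]
  have hdiag : ∀ i j, i ≠ j → M i j = 0 := by
    intro i j hij
    have := key (fun k => if k = i then -1 else 1) (by intro k; by_cases hk : k = i <;> simp [hk]) i j
    simp [hij.symm] at this
    linarith
  have hMu : M * Matrix.diagonal u = Matrix.diagonal u * M := by
    ext i j
    rw [Matrix.mul_diagonal, Matrix.diagonal_mul]
    by_cases hij : i = j
    · subst hij; ring
    · rw [hdiag i j hij]; ring
  have hmm : ∀ A B : RM n, (V * A * Vᵀ) * (V * B * Vᵀ) = V * (A * B) * Vᵀ := by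
    intro A B
    calc (V * A * Vᵀ) * (V * B * Vᵀ) = V * A * (Vᵀ * V) * B * Vᵀ := by
          simp only [Matrix.mul_assoc]
      _ = _ := by simp [hV, Matrix.mul_assoc]
  rw [hGM]
  conv_lhs => rw [hd]
  conv_rhs => rw [hd]
  rw [hmm, hmm, hMu]

lemma commute (h : ProjData K G) (U : RM n) : G U * (U + Uᵀ) = (U + Uᵀ) * G U := by
  have hs : ((1/2 : ℝ) • (U + Uᵀ)).IsSymm := by
    rw [Matrix.IsSymm]; simp [add_comm]
  have := h.commute_symm hs
  rw [h.symPart, Matrix.mul_smul, Matrix.smul_mul] at this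
  exact smul_right_injective _ (by norm_num : (1/2 : ℝ) ≠ 0) this

end ProjData

/-! ### Derivatives -/

lemma hasDerivAt_mul_entry {n : ℕ} {M N : ℝ → RM n} {M' N' : RM n} {t : ℝ}
    (hM : ∀ i j, HasDerivAt (fun t => M t i j) (M' i j) t)
    (hN : ∀ i j, HasDerivAt (fun t => N t i j) (N' i j) t) (i j : Fin n) :
    HasDerivAt (fun t => (M t * N t) i j) ((M' * N t + M t * N') i j) t := by
  simp only [Matrix.mul_apply, Matrix.add_apply, ← Finset.sum_add_distrib]
  exact HasDerivAt.fun_sum fun k _ => (hM i k).mul (hN k j)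

lemma hasDerivAt_matrix {n : ℕ} {M : ℝ → RM n} {M' : RM n} {t : ℝ} :
    HasDerivAt M M' t ↔ ∀ i j, HasDerivAt (fun t => M t i j) (M' i j) t := by
  constructor
  · intro h i j
    exact (hasDerivAt_pi.mp ((hasDerivAt_pi.mp h) i)) j
  · intro h
    exact hasDerivAt_pi.mpr fun i => hasDerivAt_pi.mpr fun j => h i j

section ExpSection

attribute [local instance] Matrix.linftyOpNormedRing Matrix.linftyOpNormedAlgebra

lemma hasDerivAt_exp_entry {n : ℕ} (A : RM n) (i j : Fin n) :
    HasDerivAt (fun t : ℝ => (NormedSpace.exp (t • A)) i j) (A i j) 0 := by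
  let _ : NormedRing (RM n) := Matrix.linftyOpNormedRing
  let _ : NormedAlgebra ℝ (RM n) := Matrix.linftyOpNormedAlgebra
  have : @CompleteSpace (RM n) (Matrix.linftyOpNormedRing (n := Fin n) (α := ℝ)).toPseudoMetricSpace.toUniformSpace :=
    @FiniteDimensional.complete ℝ (RM n) _ _ _ _ _ _ _ _ _
  have h := hasDerivAt_exp_smul_const (𝕂 := ℝ) A (0 : ℝ)
  simp only [zero_smul, NormedSpace.exp_zero, one_mul] at h
  have h2 : HasFDerivAt (fun M : RM n => M i j)
      ((Matrix.entryLinearMap ℝ ℝ i j : RM n →ₗ[ℝ] ℝ).toContinuousLinearMap) 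
      (NormedSpace.exp ((0:ℝ) • A)) :=
    ((Matrix.entryLinearMap ℝ ℝ i j : RM n →ₗ[ℝ] ℝ).toContinuousLinearMap).hasFDerivAt
  exact h2.comp_hasDerivAt (0:ℝ) h

end ExpSection

lemma exp_orth {n : ℕ} {A : RM n} (hA : Aᵀ = -A) (t : ℝ) :
    (NormedSpace.exp (t • A))ᵀ * NormedSpace.exp (t • A) = 1 := by
  rw [← Matrix.exp_transpose, Matrix.transpose_smul, hA, smul_neg, Matrix.exp_neg]
  exact Matrix.nonsing_inv_mul _ ((Matrix.isUnit_iff_isUnit_det _).mp (Matrix.isUnit_exp _))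

lemma hasDerivAt_conj {n : ℕ} {A : RM n} (hA : Aᵀ = -A) (X : RM n) :
    HasDerivAt (fun t : ℝ => NormedSpace.exp (t • A) * X * (NormedSpace.exp (t • A))ᵀ)
      (A * X - X * A) 0 := by
  rw [hasDerivAt_matrix]
  have h1 := hasDerivAt_exp_entry A
  have h2 : ∀ i j, HasDerivAt (fun t : ℝ => (NormedSpace.exp (t • A))ᵀ i j) (Aᵀ i j) 0 :=
    fun i j => h1 j i
  have h3 : ∀ i j, HasDerivAt (fun _ : ℝ => X i j) ((0 : RM n) i j) 0 :=
    fun i j => hasDerivAt_const _ _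
  have h4 := hasDerivAt_mul_entry (M := fun t : ℝ => NormedSpace.exp (t • A)) (N := fun _ => X) h1 h3
  have h5 := hasDerivAt_mul_entry (M := fun t : ℝ => NormedSpace.exp (t • A) * X)
    (N := fun t : ℝ => (NormedSpace.exp (t • A))ᵀ) h4 h2
  intro i j
  have := h5 i j
  simpa [hA, sub_eq_add_neg] using this

namespace ProjData

variable {n : ℕ} {K : Set (RM n)} {G : RM n → RM n}

lemma deriv_rot (h : ProjData K G) {U : RM n} (hd : DifferentiableAt ℝ G U) {A : RM n}
    (hA : Aᵀ = -A) : fderiv ℝ G U (A * U - U * A) = A * G U - G U * A := by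
  have h1 := hasDerivAt_conj hA U
  have h2 := hasDerivAt_conj hA (G U)
  have h0 : NormedSpace.exp ((0:ℝ) • A) * U * (NormedSpace.exp ((0:ℝ) • A))ᵀ = U := by simp
  have hd' : HasFDerivAt G (fderiv ℝ G U)
    (NormedSpace.exp ((0:ℝ) • A) * U * (NormedSpace.exp ((0:ℝ) • A))ᵀ) := by
    rw [h0]; exact hd.hasFDerivAt
  have h3 := hd'.comp_hasDerivAt (0:ℝ) h1
  have e : (G ∘ fun t : ℝ => NormedSpace.exp (t • A) * U * (NormedSpace.exp (t • A))ᵀ)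
      = fun t : ℝ => NormedSpace.exp (t • A) * G U * (NormedSpace.exp (t • A))ᵀ :=
    funext fun t => h.equivar (exp_orth hA t) U
  rw [e] at h3
  exact h3.unique h2

lemma line_deriv {U : RM n} (hd : DifferentiableAt ℝ G U) (W : RM n) :
    HasDerivAt (fun t : ℝ => G (U + t • W)) (fderiv ℝ G U W) 0 := by
  have h1 : HasDerivAt (fun t : ℝ => U + t • W) W 0 := by
    have := ((hasDerivAt_id (0:ℝ)).smul_const W).const_add U
    rw [one_smul] at this
    exact this
  have hd' : HasFDerivAt G (fderiv ℝ G U) (U + (0:ℝ) • W) := by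
    simpa using hd.hasFDerivAt
  exact hd'.comp_hasDerivAt (0:ℝ) h1

lemma deriv_comm (h : ProjData K G) {U : RM n} (hd : DifferentiableAt ℝ G U) (W : RM n) :
    fderiv ℝ G U W * (U + Uᵀ) + G U * (W + Wᵀ)
      = (W + Wᵀ) * G U + (U + Uᵀ) * fderiv ℝ G U W := by
  have h1 := hasDerivAt_matrix.mp (line_deriv hd W)
  have h2 : ∀ i j, HasDerivAt (fun t : ℝ => ((U + t • W) + (U + t • W)ᵀ) i j)
      ((W + Wᵀ) i j) 0 := by
    intro i j
    have e : ∀ i j, HasDerivAt (fun t : ℝ => U i j + t * W i j) (W i j) 0 := by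
      intro i j
      simpa using ((hasDerivAt_id (0:ℝ)).mul_const (W i j)).const_add (U i j)
    exact (e i j).add (e j i)
  have h3 := hasDerivAt_mul_entry h1 h2
  have h4 := hasDerivAt_mul_entry h2 h1
  ext i j
  have e0 : (fun t : ℝ => (G (U + t • W) * (U + t • W + (U + t • W)ᵀ)) i j)
      = fun t : ℝ => ((U + t • W + (U + t • W)ᵀ) * G (U + t • W)) i j :=
    funext fun t => by rw [h.commute]
  have h5 := h3 i j
  rw [e0] at h5
  have e := h5.unique (h4 i j)
  simpa using e

lemma deriv_firm (h : ProjData K G) {U : RM n} (hd : DifferentiableAt ℝ G U) (W : RM n) :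
    mip (fderiv ℝ G U W) (fderiv ℝ G U W) ≤ mip (fderiv ℝ G U W) W := by
  have h1 := (hasDerivAt_iff_tendsto_slope_zero.mp (line_deriv hd W))
  simp only [zero_add, zero_smul, add_zero] at h1
  have c1 : Continuous fun M : RM n => mip M M := continuous_mip continuous_id continuous_id
  have c2 : Continuous fun M : RM n => mip M W := continuous_mip continuous_id continuous_const
  refine le_of_tendsto_of_tendsto ((c1.tendsto _).comp h1) ((c2.tendsto _).comp h1) ?_
  filter_upwards [self_mem_nhdsWithin] with t ht
  have ht' : t ≠ 0 := ht
  have := h.firm U (U + t • W)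
  rw [add_sub_cancel_left, mip_smul_right] at this
  simp only [Function.comp, mip_smul_left, mip_smul_right]
  have h3 : 0 ≤ t⁻¹ * t⁻¹ := mul_self_nonneg _
  have h4 := mul_le_mul_of_nonneg_left this h3
  have h5 : t⁻¹ * t⁻¹ * (t * mip (G (U + t • W) - G U) W) = t⁻¹ * mip (G (U + t • W) - G U) W := by
    field_simp
  rw [h5] at h4
  linarith

end ProjData

/-! ### The set `K` -/

lemma pwa_le_zero_iff {n q : ℕ} [NeZero q] (b : Fin q → Fin n → ℝ) (d : Fin q → ℝ)
    (x : Fin n → ℝ) : pwa b d x ≤ 0 ↔ ∀ w, b w ⬝ᵥ x ≤ d w := by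
  unfold pwa
  constructor
  · intro h w
    have := le_ciSup (f := fun i => b i ⬝ᵥ x - d i) (Set.finite_range _).bddAbove w
    linarith
  · intro h
    apply ciSup_le
    intro w
    linarith [h w]

lemma lamVec_antitone {n : ℕ} {X : RM n} (h : X.IsHermitian) : Antitone (lamVec X) := by
  intro i j hij
  simp only [lamVec, dif_pos h]
  exact Tuple.monotone_sort h.eigenvalues (Fin.rev_le_rev.mpr hij)

lemma pwa_lamVec {n q : ℕ} [NeZero q] (b : Fin q → Fin n → ℝ) (d : Fin q → ℝ)
    (hsym : ∀ (σ : Equiv.Perm (Fin n)) (x : Fin n → ℝ), pwa b d (x ∘ σ) = pwa b d x)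
    {X : RM n} (h : X.IsHermitian) : pwa b d (lamVec X) = pwa b d h.eigenvalues := by
  rw [← hsym (Fin.revPerm.trans (Tuple.sort h.eigenvalues)) h.eigenvalues]
  congr 1
  funext i
  rw [lamVec, dif_pos h]
  rfl

lemma kchar {n q : ℕ} [NeZero q] (b : Fin q → Fin n → ℝ) (d : Fin q → ℝ)
    (hsym : ∀ (σ : Equiv.Perm (Fin n)) (x : Fin n → ℝ), pwa b d (x ∘ σ) = pwa b d x)
    {X : RM n} (hX : X.IsSymm) : pwa b d (lamVec X) ≤ 0 ↔
      ∀ V : RM n, Vᵀ * V = 1 → ∀ w, b w ⬝ᵥ (fun i => (Vᵀ * X * V) i i) ≤ d w := by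
  have h := isHermitian_of_isSymm hX
  rw [pwa_lamVec b d hsym h]
  obtain ⟨U, hU, hd⟩ := spectral_real h
  set e := h.eigenvalues with he
  constructor
  · intro hp V hV w
    have hU' : U * Uᵀ = 1 := mul_eq_one_comm.mp hU
    have hV' : V * Vᵀ = 1 := mul_eq_one_comm.mp hV
    set T := Vᵀ * U with hT
    have hT1 : Tᵀ * T = 1 := by
      calc Tᵀ * T = Uᵀ * (V * Vᵀ) * U := by
            rw [hT]; simp only [Matrix.transpose_mul, Matrix.transpose_transpose, Matrix.mul_assoc]
        _ = 1 := by simp [hV', hU]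
    have hT2 : T * Tᵀ = 1 := mul_eq_one_comm.mp hT1
    have hD : (Matrix.of fun i j => T i j * T i j : RM n) ∈ doublyStochastic ℝ (Fin n) := by
      rw [mem_doublyStochastic_iff_sum]
      refine ⟨fun i j => mul_self_nonneg _, fun i => ?_, fun j => ?_⟩
      · have := congrFun (congrFun hT2 i) i
        simpa [Matrix.mul_apply] using this
      · have := congrFun (congrFun hT1 j) j
        simpa [Matrix.mul_apply] using this
    have hdiag : (fun i => (Vᵀ * X * V) i i)
        = (Matrix.of fun i j => T i j * T i j : RM n) *ᵥ e := by
      funext i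
      have : Vᵀ * X * V = T * Matrix.diagonal e * Tᵀ := by
        rw [hd, hT]
        simp only [Matrix.transpose_mul, Matrix.transpose_transpose, Matrix.mul_assoc]
      rw [this, Matrix.mul_apply]
      simp only [Matrix.mul_diagonal, Matrix.transpose_apply, Matrix.mulVec, dotProduct,
        Matrix.of_apply]
      exact Finset.sum_congr rfl fun j _ => by ring
    rw [hdiag]
    have hsub : (doublyStochastic ℝ (Fin n) : Set (RM n)) ⊆ {D : RM n | b w ⬝ᵥ (D *ᵥ e) ≤ d w} := by
      rw [doublyStochastic_eq_convexHull_permMatrix]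
      apply convexHull_min
      · rintro _ ⟨σ, rfl⟩
        simp only [Set.mem_ofPred_eq, Matrix.permMatrix_mulVec]
        rw [← hsym σ] at hp
        exact (pwa_le_zero_iff b d _).mp hp w
      · intro D hD D' hD' s t hs ht hst
        simp only [Set.mem_ofPred_eq] at *
        rw [Matrix.add_mulVec, Matrix.smul_mulVec, Matrix.smul_mulVec, dotProduct_add,
          dotProduct_smul, dotProduct_smul, smul_eq_mul, smul_eq_mul]
        have : d w = s * d w + t * d w := by rw [← add_mul, hst, one_mul]
        rw [this]
        gcongr
    exact hsub hD
  · intro hp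
    rw [pwa_le_zero_iff]
    intro w
    have := hp U hU w
    convert this using 3 with i
    have e1 : Uᵀ * X * U = (Uᵀ * U) * Matrix.diagonal e * (Uᵀ * U) := by
      conv_lhs => rw [hd]
      simp only [Matrix.mul_assoc]
    rw [e1, hU]
    simp

lemma projData_of {n q : ℕ} [NeZero q] (b : Fin q → Fin n → ℝ) (d : Fin q → ℝ)
    (hsym : ∀ (σ : Equiv.Perm (Fin n)) (x : Fin n → ℝ), pwa b d (x ∘ σ) = pwa b d x)
    {K : Set (RM n)} (hK : K = {X | X.IsSymm ∧ pwa b d (lamVec X) ≤ 0}) (hne : K.Nonempty) :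
    ProjData K (projM K) := by
  have hK' : K = {X | X.IsSymm ∧
      ∀ V : RM n, Vᵀ * V = 1 → ∀ w, b w ⬝ᵥ (fun i => (Vᵀ * X * V) i i) ≤ d w} := by
    rw [hK]; ext X
    simp only [Set.mem_ofPred_eq]
    exact and_congr_right fun hX => kchar b d hsym hX
  have hcl : IsClosed K := by
    rw [hK']
    have h1 : IsClosed {X : RM n | X.IsSymm} :=
      isClosed_eq continuous_id.matrix_transpose continuous_id
    have h2 : IsClosed {X : RM n | ∀ V : RM n, Vᵀ * V = 1 → ∀ w,
        b w ⬝ᵥ (fun i => (Vᵀ * X * V) i i) ≤ d w} := by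
      simp only [Set.ofPred_forall]
      refine isClosed_iInter fun V => isClosed_iInter fun _ => isClosed_iInter fun w => ?_
      refine isClosed_le ?_ continuous_const
      simp only [dotProduct]
      refine continuous_finsetSum _ fun i _ => continuous_const.mul ?_
      exact ((continuous_const.matrix_mul continuous_id).matrix_mul continuous_const).matrix_elem i i
    exact h1.inter h2
  have hcv : Convex ℝ K := by
    rw [hK']
    rintro X ⟨hX, hX'⟩ Y ⟨hY, hY'⟩ s t hs ht hst
    refine ⟨?_, fun V hV w => ?_⟩
    · rw [Matrix.IsSymm, Matrix.transpose_add, Matrix.transpose_smul, Matrix.transpose_smul,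
        hX.eq, hY.eq]
    · have e : (fun i => (Vᵀ * (s • X + t • Y) * V) i i)
          = s • (fun i => (Vᵀ * X * V) i i) + t • (fun i => (Vᵀ * Y * V) i i) := by
        funext i
        simp [Matrix.mul_add, Matrix.add_mul]
      rw [e, dotProduct_add, dotProduct_smul, dotProduct_smul, smul_eq_mul, smul_eq_mul]
      have : d w = s * d w + t * d w := by rw [← add_mul, hst, one_mul]
      rw [this]
      have := hX' V hV w
      have := hY' V hV w
      gcongr
  refine ⟨fun X => (projM_isProj hne hcl X).1, fun X Y hY => (projM_isProj hne hcl X).vi hcv hY,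
    ?_, ?_⟩
  · intro X hX
    rw [hK] at hX
    exact hX.1
  · intro R hR X hX
    rw [hK'] at hX ⊢
    refine ⟨?_, fun V hV w => ?_⟩
    · rw [Matrix.IsSymm]
      simp only [Matrix.transpose_mul, Matrix.transpose_transpose, hX.1.eq, Matrix.mul_assoc]
    · have hR' : R * Rᵀ = 1 := mul_eq_one_comm.mp hR
      have := hX.2 (Rᵀ * V) (by
        calc (Rᵀ * V)ᵀ * (Rᵀ * V) = Vᵀ * (R * Rᵀ) * V := by
              simp only [Matrix.transpose_mul, Matrix.transpose_transpose, Matrix.mul_assoc]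
          _ = 1 := by simp [hR', hV]) w
      simpa only [Matrix.transpose_mul, Matrix.transpose_transpose, Matrix.mul_assoc] using this

/-! ### Moore–Penrose inverse and the sigma term -/

lemma penrose_unique {n : ℕ} {A B C : RM n}
    (hB : A * B * A = A ∧ B * A * B = B ∧ (A * B)ᵀ = A * B ∧ (B * A)ᵀ = B * A)
    (hC : A * C * A = A ∧ C * A * C = C ∧ (A * C)ᵀ = A * C ∧ (C * A)ᵀ = C * A) : B = C := by
  obtain ⟨b1, b2, b3, b4⟩ := hB
  obtain ⟨c1, c2, c3, c4⟩ := hC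
  have h1 : A * B = A * C := by
    calc A * B = (A * C * A) * B := by rw [c1]
      _ = (A * C) * (A * B) := by simp only [Matrix.mul_assoc]
      _ = (A * C)ᵀ * (A * B)ᵀ := by rw [b3, c3]
      _ = ((A * B * A) * C)ᵀ := by
          rw [← Matrix.transpose_mul]; simp only [Matrix.mul_assoc]
      _ = A * C := by rw [b1, c3]
  have h2 : B * A = C * A := by
    calc B * A = B * (A * C * A) := by rw [c1]
      _ = (B * A) * (C * A) := by simp only [Matrix.mul_assoc]
      _ = (B * A)ᵀ * (C * A)ᵀ := by rw [b4, c4]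
      _ = (C * (A * B * A))ᵀ := by
          rw [← Matrix.transpose_mul]; simp only [Matrix.mul_assoc]
      _ = C * A := by rw [b1, c4]
  calc B = B * A * B := b2.symm
    _ = C * (A * B) := by rw [h2, Matrix.mul_assoc]
    _ = C * A * C := by rw [h1, Matrix.mul_assoc]
    _ = C := c2

lemma vconj_mul {n : ℕ} {V : RM n} (hV : Vᵀ * V = 1) (A B : RM n) :
    (V * A * Vᵀ) * (V * B * Vᵀ) = V * (A * B) * Vᵀ := by
  calc (V * A * Vᵀ) * (V * B * Vᵀ) = V * A * (Vᵀ * V) * B * Vᵀ := by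
        simp only [Matrix.mul_assoc]
    _ = _ := by simp [hV, Matrix.mul_assoc]

lemma vconj_inv {n : ℕ} {V : RM n} (hV : Vᵀ * V = 1) (A : RM n) : Vᵀ * (V * A * Vᵀ) * V = A := by
  calc Vᵀ * (V * A * Vᵀ) * V = (Vᵀ * V) * A * (Vᵀ * V) := by simp only [Matrix.mul_assoc]
    _ = A := by simp [hV]

lemma vconj_inv' {n : ℕ} {V : RM n} (hV : Vᵀ * V = 1) (A : RM n) : V * (Vᵀ * A * V) * Vᵀ = A := by
  have hV' : V * Vᵀ = 1 := mul_eq_one_comm.mp hV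
  calc V * (Vᵀ * A * V) * Vᵀ = (V * Vᵀ) * A * (V * Vᵀ) := by simp only [Matrix.mul_assoc]
    _ = A := by simp [hV']

lemma vconj_sub {n : ℕ} (V A B : RM n) :
    V * A * Vᵀ - V * B * Vᵀ = V * (A - B) * Vᵀ := by
  rw [Matrix.mul_sub, Matrix.sub_mul]

lemma mpInv_conj {n : ℕ} {V : RM n} (hV : Vᵀ * V = 1) (a : Fin n → ℝ) :
    mpInv (V * Matrix.diagonal a * Vᵀ) = V * Matrix.diagonal (fun j => (a j)⁻¹) * Vᵀ := by
  have hsp : (V * Matrix.diagonal a * Vᵀ) * (V * Matrix.diagonal (fun j => (a j)⁻¹) * Vᵀ)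
        * (V * Matrix.diagonal a * Vᵀ) = V * Matrix.diagonal a * Vᵀ ∧
      (V * Matrix.diagonal (fun j => (a j)⁻¹) * Vᵀ) * (V * Matrix.diagonal a * Vᵀ)
        * (V * Matrix.diagonal (fun j => (a j)⁻¹) * Vᵀ)
          = V * Matrix.diagonal (fun j => (a j)⁻¹) * Vᵀ ∧
      ((V * Matrix.diagonal a * Vᵀ) * (V * Matrix.diagonal (fun j => (a j)⁻¹) * Vᵀ))ᵀ
        = (V * Matrix.diagonal a * Vᵀ) * (V * Matrix.diagonal (fun j => (a j)⁻¹) * Vᵀ) ∧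
      ((V * Matrix.diagonal (fun j => (a j)⁻¹) * Vᵀ) * (V * Matrix.diagonal a * Vᵀ))ᵀ
        = (V * Matrix.diagonal (fun j => (a j)⁻¹) * Vᵀ) * (V * Matrix.diagonal a * Vᵀ) := by
    simp only [vconj_mul hV, Matrix.diagonal_mul_diagonal]
    refine ⟨?_, ?_, ?_, ?_⟩
    · congr 3; funext i
      by_cases h : a i = 0 <;> simp [h]
    · congr 3; funext i
      by_cases h : a i = 0 <;> simp [h]
    · simp [Matrix.mul_assoc]
    · simp [Matrix.mul_assoc]
  exact penrose_unique (Classical.epsilon_spec (p := fun B : RM n =>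
    (V * Matrix.diagonal a * Vᵀ) * B * (V * Matrix.diagonal a * Vᵀ) = V * Matrix.diagonal a * Vᵀ ∧
    B * (V * Matrix.diagonal a * Vᵀ) * B = B ∧
    ((V * Matrix.diagonal a * Vᵀ) * B)ᵀ = (V * Matrix.diagonal a * Vᵀ) * B ∧
    (B * (V * Matrix.diagonal a * Vᵀ))ᵀ = B * (V * Matrix.diagonal a * Vᵀ)) ⟨_, hsp⟩) hsp

lemma upsilon_eq {n : ℕ} {X Z V : RM n} (hV : Vᵀ * V = 1)
    (hX : X = V * Matrix.diagonal (lamVec X) * Vᵀ) {H : RM n} (hH : H.IsSymm) :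
    -(Upsilon X Z V H) = ∑ i, ∑ j, (lamVec Z i - lamVec Z j) * (lamVec X i - lamVec X j)⁻¹
      * ((Vᵀ * H * V) i j) ^ 2 := by
  set x := lamVec X with hx
  set z := lamVec Z with hz
  set Hv := Vᵀ * H * V with hHv
  have hV' : V * Vᵀ = 1 := mul_eq_one_comm.mp hV
  have hsym : ∀ i j, Hv j i = Hv i j := by
    have : Hvᵀ = Hv := by
      rw [hHv]
      simp only [Matrix.transpose_mul, Matrix.transpose_transpose, hH.eq, Matrix.mul_assoc]
    intro i j
    exact congrFun (congrFun this i) j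
  have key : ∀ i, (Vᵀ * H * mpInv (X - x i • (1 : RM n)) * H * V) i i
      = ∑ j, (x j - x i)⁻¹ * Hv i j ^ 2 := by
    intro i
    have e1 : X - x i • (1 : RM n) = V * Matrix.diagonal (fun j => x j - x i) * Vᵀ := by
      have : (x i • (1 : RM n)) = V * Matrix.diagonal (fun _ => x i) * Vᵀ := by
        rw [← Matrix.smul_one_eq_diagonal, Matrix.mul_smul, Matrix.smul_mul, Matrix.mul_one, hV']
      rw [this]
      conv_lhs => rw [hX]
      rw [vconj_sub, Matrix.diagonal_sub]
    rw [e1, mpInv_conj hV]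
    have e2 : Vᵀ * H * (V * Matrix.diagonal (fun j => (x j - x i)⁻¹) * Vᵀ) * H * V
        = Hv * Matrix.diagonal (fun j => (x j - x i)⁻¹) * Hv := by
      simp only [hHv, Matrix.mul_assoc]
    rw [e2, Matrix.mul_apply]
    refine Finset.sum_congr rfl fun j _ => ?_
    rw [Matrix.mul_diagonal, hsym i j]
    ring
  unfold Upsilon
  simp only [← hx, ← hz, key]
  have s1 : ∑ i, ∑ j, (z i - z j) * (x i - x j)⁻¹ * Hv i j ^ 2
      = (∑ i, ∑ j, z i * (x i - x j)⁻¹ * Hv i j ^ 2)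
        - ∑ i, ∑ j, z j * (x i - x j)⁻¹ * Hv i j ^ 2 := by
    rw [← Finset.sum_sub_distrib]
    refine Finset.sum_congr rfl fun i _ => ?_
    rw [← Finset.sum_sub_distrib]
    exact Finset.sum_congr rfl fun j _ => by ring
  have s2 : ∑ i, ∑ j, z j * (x i - x j)⁻¹ * Hv i j ^ 2
      = ∑ i, ∑ j, z i * (x j - x i)⁻¹ * Hv i j ^ 2 := by
    rw [Finset.sum_comm]
    exact Finset.sum_congr rfl fun i _ => Finset.sum_congr rfl fun j _ => by rw [hsym i j]
  have s3 : ∑ i, ∑ j, z i * (x i - x j)⁻¹ * Hv i j ^ 2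
      = - ∑ i, ∑ j, z i * (x j - x i)⁻¹ * Hv i j ^ 2 := by
    simp only [← Finset.sum_neg_distrib]
    refine Finset.sum_congr rfl fun i _ => Finset.sum_congr rfl fun j _ => ?_
    rw [← neg_sub (x j) (x i), inv_neg]; ring
  have s4 : ∑ i, z i * ∑ j, (x j - x i)⁻¹ * Hv i j ^ 2
      = ∑ i, ∑ j, z i * (x j - x i)⁻¹ * Hv i j ^ 2 := by
    refine Finset.sum_congr rfl fun i _ => ?_
    rw [Finset.mul_sum]
    exact Finset.sum_congr rfl fun j _ => by ring
  rw [s1, s2, s3, s4]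
  ring

/-! ### Properties of Clarke's generalized Jacobian -/

def GoodS {n : ℕ} (X U : RM n) : Set (RM n →L[ℝ] RM n) :=
  {S | (∀ W : RM n, S W * (U + Uᵀ) + X * (W + Wᵀ) = (W + Wᵀ) * X + (U + Uᵀ) * S W) ∧
    (∀ A : RM n, Aᵀ = -A → S (A * U - U * A) = A * X - X * A) ∧
    (∀ W : RM n, mip (S W) (S W) ≤ mip (S W) W)}

lemma goodS_convex {n : ℕ} (X U : RM n) : Convex ℝ (GoodS X U) := by
  rintro S ⟨s1, s2, s3⟩ T ⟨t1, t2, t3⟩ a c ha hc hac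
  refine ⟨fun W => ?_, fun A hA => ?_, fun W => ?_⟩
  · have h1 := congrArg (fun M => a • M) (s1 W)
    have h2 := congrArg (fun M => c • M) (t1 W)
    simp only [_root_.add_apply, _root_.smul_apply, Matrix.add_mul _ _ (U + Uᵀ),
      Matrix.mul_add (U + Uᵀ), Matrix.smul_mul, Matrix.mul_smul]
    simp only [smul_add] at h1 h2
    have e1 : X * (W + Wᵀ) = a • (X * (W + Wᵀ)) + c • (X * (W + Wᵀ)) := by
      rw [← add_smul, hac, one_smul]
    have e2 : (W + Wᵀ) * X = a • ((W + Wᵀ) * X) + c • ((W + Wᵀ) * X) := by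
      rw [← add_smul, hac, one_smul]
    rw [e1, e2]
    calc _ = (a • (S W * (U + Uᵀ)) + a • (X * (W + Wᵀ)))
          + (c • (T W * (U + Uᵀ)) + c • (X * (W + Wᵀ))) := by abel
      _ = _ := by rw [h1, h2]; abel
  · simp only [_root_.add_apply, _root_.smul_apply, s2 A hA, t2 A hA]
    rw [← add_smul, hac, one_smul]
  · have h1 := s3 W
    have h2 := t3 W
    have h3 := mip_self_nonneg (S W - T W)
    simp only [_root_.add_apply, _root_.smul_apply, mip_add_left,
      mip_add_right, mip_smul_left, mip_smul_right]
    simp only [mip_sub_left, mip_sub_right] at h3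
    rw [mip_comm' (T W) (S W)] at h3 ⊢
    have hc' : c = 1 - a := by linarith
    subst hc'
    nlinarith [mul_le_mul_of_nonneg_left h1 ha, mul_le_mul_of_nonneg_left h2 hc,
      mul_nonneg (mul_nonneg ha hc) h3]

lemma clarke_subset {n : ℕ} {K : Set (RM n)} {G : RM n → RM n} (h : ProjData K G) (U : RM n) :
    clarkeJacobian G U ⊆ GoodS (G U) U := by
  apply convexHull_min _ (goodS_convex _ _)
  rintro L ⟨u, hd, hu, hL⟩
  have hG : Tendsto (fun k => G (u k)) atTop (𝓝 (G U)) := (h.cont.tendsto U).comp hu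
  have hut : Tendsto (fun k => u k + (u k)ᵀ) atTop (𝓝 (U + Uᵀ)) := by
    have c : Continuous fun M : RM n => M + Mᵀ := continuous_id.add continuous_id.matrix_transpose
    exact (c.tendsto U).comp hu
  have hLW : ∀ W, Tendsto (fun k => fderiv ℝ G (u k) W) atTop (𝓝 (L W)) := fun W =>
    ((ContinuousLinearMap.apply ℝ (RM n) W).continuous.tendsto L).comp hL
  refine ⟨fun W => ?_, fun A hA => ?_, fun W => ?_⟩
  · refine tendsto_nhds_unique (((hLW W).mul hut).add (hG.mul_const (W + Wᵀ))) ?_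
    simp only [h.deriv_comm (hd _) W]
    exact (hG.const_mul (W + Wᵀ)).add (hut.mul (hLW W))
  · have cA : Continuous fun M : RM n => A * M - M * A :=
      (continuous_const.matrix_mul continuous_id).sub (continuous_id.matrix_mul continuous_const)
    have h1 : Tendsto (fun k => A * u k - u k * A) atTop (𝓝 (A * U - U * A)) :=
      (cA.tendsto U).comp hu
    have h2 : Tendsto (fun k => fderiv ℝ G (u k) (A * u k - u k * A)) atTop
        (𝓝 (L (A * U - U * A))) := (isBoundedBilinearMap_apply.continuous.tendsto (L, A * U - U * A)).comp
          (hL.prodMk_nhds h1)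
    refine tendsto_nhds_unique h2 ?_
    simp only [h.deriv_rot (hd _) hA]
    exact (cA.tendsto _).comp hG
  · have c1 : Continuous fun M : RM n => mip M M := continuous_mip continuous_id continuous_id
    have c2 : Continuous fun M : RM n => mip M W := continuous_mip continuous_id continuous_const
    exact le_of_tendsto_of_tendsto' ((c1.tendsto _).comp (hLW W)) ((c2.tendsto _).comp (hLW W))
      fun k => h.deriv_firm (hd k) W

lemma goodS_final {n : ℕ} {V : RM n} (hV : Vᵀ * V = 1) {x z : Fin n → ℝ}
    (hx : Antitone x) (hz : Antitone z) {X U : RM n}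
    (hX : X = V * Matrix.diagonal x * Vᵀ)
    (hU : U = V * Matrix.diagonal (fun i => x i + z i) * Vᵀ)
    {S : RM n →L[ℝ] RM n} (hS : S ∈ GoodS X U) {W H : RM n} (hW : W.IsSymm)
    (hH : S W = H) :
    ∑ i, ∑ j, (z i - z j) * (x i - x j)⁻¹ * ((Vᵀ * H * V) i j) ^ 2 ≤ mip H (W - H) := by
  obtain ⟨s1, s2, s3⟩ := hS
  set u : Fin n → ℝ := fun i => x i + z i with hu
  set Hv := Vᵀ * H * V with hHv
  set Wv := Vᵀ * W * V with hWv
  have hHc : H = V * Hv * Vᵀ := (vconj_inv' hV H).symm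
  have hWc : W = V * Wv * Vᵀ := (vconj_inv' hV W).symm
  have hWsym : ∀ i j, Wv j i = Wv i j := by
    have : Wvᵀ = Wv := by
      rw [hWv]
      simp only [Matrix.transpose_mul, Matrix.transpose_transpose, hW.eq, Matrix.mul_assoc]
    intro i j
    exact congrFun (congrFun this i) j
  have hUsym : Uᵀ = U := by
    rw [hU]; simp [Matrix.mul_assoc]
  have inj : ∀ A B : RM n, V * A * Vᵀ = V * B * Vᵀ → A = B := by
    intro A B h
    rw [← vconj_inv hV A, h, vconj_inv hV B]
  -- first-order relation coming from commutation
  have rel : ∀ i j, Hv i j * (u i - u j) = (x i - x j) * Wv i j := by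
    have h1 := s1 W
    rw [hH, hW.eq, hUsym, ← two_smul ℝ U, ← two_smul ℝ W] at h1
    simp only [Matrix.mul_smul, Matrix.smul_mul, ← smul_add] at h1
    have h2 := smul_right_injective _ (by norm_num : (2 : ℝ) ≠ 0) h1
    rw [hHc, hWc, hU, hX, vconj_mul hV, vconj_mul hV, vconj_mul hV, vconj_mul hV,
      ← Matrix.add_mul, ← Matrix.add_mul, ← Matrix.mul_add, ← Matrix.mul_add] at h2
    have h3 := inj _ _ h2
    intro i j
    have h4 := congrFun (congrFun h3 i) j
    simp only [Matrix.add_apply, Matrix.mul_diagonal, Matrix.diagonal_mul] at h4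
    linarith
  set Av : RM n := Matrix.of fun i j => Wv i j * (u j - u i)⁻¹ with hAv
  have hAt : (V * Av * Vᵀ)ᵀ = -(V * Av * Vᵀ) := by
    have : Avᵀ = -Av := by
      ext i j
      simp only [hAv, Matrix.transpose_apply, Matrix.of_apply, Matrix.neg_apply, hWsym i j]
      rw [← neg_sub (u j) (u i), inv_neg]; ring
    simp only [Matrix.transpose_mul, Matrix.transpose_transpose, this, ← Matrix.mul_assoc]
    simp
  have hrot := s2 _ hAt
  set W1 : RM n := Av * Matrix.diagonal u - Matrix.diagonal u * Av with hW1
  set H1 : RM n := Av * Matrix.diagonal x - Matrix.diagonal x * Av with hH1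
  rw [hU, hX, vconj_mul hV, vconj_mul hV, vconj_mul hV, vconj_mul hV, vconj_sub, vconj_sub,
    ← hW1, ← hH1] at hrot
  have hW1e : ∀ i j, W1 i j = Wv i j * (u j - u i)⁻¹ * (u j - u i) := by
    intro i j
    simp only [hW1, Matrix.sub_apply, Matrix.mul_diagonal, Matrix.diagonal_mul, hAv,
      Matrix.of_apply]
    ring
  have hH1e : ∀ i j, H1 i j = Wv i j * (u j - u i)⁻¹ * (x j - x i) := by
    intro i j
    simp only [hH1, Matrix.sub_apply, Matrix.mul_diagonal, Matrix.diagonal_mul, hAv,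
      Matrix.of_apply]
    ring
  have hfirm := s3 (W - V * W1 * Vᵀ)
  rw [map_sub, hH, hrot] at hfirm
  rw [hHc, hWc, vconj_sub, vconj_sub, mip_conj hV, mip_conj hV] at hfirm
  have hgoal : mip H (W - H) = mip Hv (Wv - Hv) := by
    rw [hHc, hWc, vconj_sub, mip_conj hV]
  rw [hgoal]
  rw [mip_eq] at hfirm ⊢
  rw [mip_eq, ← sub_nonneg] at hfirm
  rw [← sub_nonneg]
  refine hfirm.trans (le_of_eq ?_)
  simp only [← Finset.sum_sub_distrib]
  refine Finset.sum_congr rfl fun i _ => Finset.sum_congr rfl fun j _ => ?_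
  simp only [Matrix.sub_apply, hW1e, hH1e]
  have hr := rel i j
  by_cases hij : u i = u j
  · have hxx : x i = x j := by
      rcases le_total i j with h | h
      · have := hx h; have := hz h; simp only [hu] at hij; linarith
      · have := hx h; have := hz h; simp only [hu] at hij; linarith
    rw [hij, hxx]
    simp
    ring
  · have hne : u j - u i ≠ 0 := sub_ne_zero.mpr (Ne.symm hij)
    have e1 : Wv i j * (u j - u i)⁻¹ * (u j - u i) = Wv i j := by field_simp
    have e2 : Wv i j * (u j - u i)⁻¹ * (x j - x i) = Hv i j := by
      field_simp
      linarith
    rw [e1, e2, sub_self, sub_self]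
    by_cases hxx : x i = x j
    · have : Hv i j = 0 := by
        rw [hxx, sub_self, zero_mul] at hr
        rcases mul_eq_zero.mp hr with h | h
        · exact h
        · exact absurd (by linarith) hij
      rw [this]; ring
    · have hxne : x i - x j ≠ 0 := sub_ne_zero.mpr hxx
      have : Wv i j = Hv i j * (u i - u j) * (x i - x j)⁻¹ := by
        field_simp; linarith
      rw [this]
      simp only [hu]
      field_simp
      ring

/-- Lemma 4.6.  For `Z̄ ∈ N_K(X̄)`, any `S ∈ ∂Π_K(X̄+Z̄)` (Clarke's
generalized Jacobian of the metric projection onto `K`) and any symmetric pair `(ΔX, ΔZ)`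
with `ΔX = S(ΔX + ΔZ)`, one has `⟨ΔX, ΔZ⟩ ≥ -Υ²_{X̄}(Z̄, ΔX)`. -/
theorem stmt16 {n q : ℕ} [NeZero q]
    (b : Fin q → Fin n → ℝ) (d : Fin q → ℝ)
    (hsym : ∀ (σ : Equiv.Perm (Fin n)) (x : Fin n → ℝ), pwa b d (x ∘ σ) = pwa b d x)
    (zeta : Matrix (Fin n) (Fin n) ℝ → ℝ)
    (hzeta : zeta = fun X => pwa b d (lamVec X))
    (K : Set (Matrix (Fin n) (Fin n) ℝ))
    (hK : K = {X | X.IsSymm ∧ zeta X ≤ 0})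
    (hSlater : ∃ Xt : Matrix (Fin n) (Fin n) ℝ, Xt.IsSymm ∧ zeta Xt < 0)
    (Xb : Matrix (Fin n) (Fin n) ℝ) (hXbK : Xb ∈ K)
    (Zb : Matrix (Fin n) (Fin n) ℝ) (hZb : Zb ∈ NK K Xb)
    (S : Matrix (Fin n) (Fin n) ℝ →L[ℝ] Matrix (Fin n) (Fin n) ℝ)
    (hS : S ∈ clarkeJacobian (projM K) (Xb + Zb))
    (DX DZ : Matrix (Fin n) (Fin n) ℝ) (hDX : DX.IsSymm) (hDZ : DZ.IsSymm)
    (hfix : DX = S (DX + DZ)) :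
    ∀ Vb ∈ OSet Xb ∩ OSet Zb, mip DX DZ ≥ -(Upsilon Xb Zb Vb DX) := by
  rintro Vb ⟨⟨hV, hX⟩, ⟨_, hZ⟩⟩
  subst hzeta
  have hD : ProjData K (projM K) := projData_of b d hsym hK ⟨Xb, hXbK⟩
  have hXs : Xb.IsSymm := hD.symm Xb hXbK
  have hG : projM K (Xb + Zb) = Xb := by
    refine vi_unique hXbK ?_ (hD.mem _) (hD.vi _)
    intro Y hY
    rw [add_sub_cancel_left]
    exact hZb.2 Y hY
  have hgood := clarke_subset hD (Xb + Zb) hS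
  rw [hG] at hgood
  have hU : Xb + Zb = Vb * Matrix.diagonal (fun i => lamVec Xb i + lamVec Zb i) * Vbᵀ := by
    rw [← Matrix.diagonal_add, Matrix.mul_add, Matrix.add_mul, ← hX, ← hZ]
  have hfin := goodS_final hV (lamVec_antitone (isHermitian_of_isSymm hXs))
    (lamVec_antitone (isHermitian_of_isSymm hZb.1)) hX hU hgood
    (W := DX + DZ) (H := DX) (hDX.add hDZ) hfix.symm
  rw [add_sub_cancel_left] at hfin
  rw [ge_iff_le, upsilon_eq hV hX hDX]
  exact hfin

end
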